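/- Regard ℂ² = ℂ × ℂ as a commutative ring with coordinatewise multiplication, and let s : ℂ² → ℂ² be the coordinate swap, s(x,y) = (y,x). There do not exist functions β₁, β₂ : ℂ² → ℂ² such that: (i) β₁(b) = s(b) + b for all b ∈ ℂ², and (ii) for all b₁, b₂, b₃ ∈ ℂ², β₁(b₁·β₂(b₂)·b₃) + β₁(b₁)·b₂·β₁(b₃) = s(b₁·b₂·b₃) + b₁·s(b₂)·b₃ + s(b₁)·b₂·s(b₃) + s(b₁)·b₂·b₃ + b₁·b₂·s(b₃) + b₁·b₂·b₃. -/

import Mathlib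

/-- `ℂ² = ℂ × ℂ` with coordinatewise operations; `Prod.swap` is the coordinate
swap `s(x, y) = (y, x)`. There are no functions `β₁, β₂` matching the second and
fourth moments, so the free convolution of the two Bernoulli distributions with
parameters `α₁ = s`, `α₂ = id` is not a Jacobi–Szegő distribution. -/
theorem stmt14 :
    ¬ ∃ (β₁ β₂ : ℂ × ℂ → ℂ × ℂ),
      (∀ b : ℂ × ℂ, β₁ b = Prod.swap b + b) ∧
      (∀ b₁ b₂ b₃ : ℂ × ℂ,
        β₁ (b₁ * β₂ b₂ * b₃) + β₁ b₁ * b₂ * β₁ b₃ =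
          Prod.swap (b₁ * b₂ * b₃) + b₁ * Prod.swap b₂ * b₃
            + Prod.swap b₁ * b₂ * Prod.swap b₃
            + Prod.swap b₁ * b₂ * b₃ + b₁ * b₂ * Prod.swap b₃ + b₁ * b₂ * b₃) := by
  rintro ⟨β₁, β₂, h₁, h₂⟩
  have h := h₂ 1 (1, 0) 1
  simp only [h₁, Prod.ext_iff, Prod.fst_add, Prod.snd_add, Prod.fst_mul, Prod.snd_mul,
    Prod.fst_swap, Prod.snd_swap, Prod.fst_one, Prod.snd_one] at h
  obtain ⟨hfst, hsnd⟩ := h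
  have : (2 : ℂ) = 0 := by linear_combination hfst - hsnd
  norm_num at this
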